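/- arXiv:2504.09239 — 2 statements merged into one kernel-verified Lean document; each statement's English description precedes it below -/
import Mathlib

section
/- Define c : ℕ → ℕ by letting c(n) be the number of L-submodules M ⊆ L with |L/M| = p^n that are free as L-modules. Then in the ring of formal power series ℤ⟦X⟧ one has (1 − X)^2 · ∑_{n≥1} c(n)·X^n = (p−1)·X^2. (Equivalently, the zeta function Z_coh(L; s) = ∑_{n≥1} c(n)p^{−ns} equals (p−1)p^{−2s}/(1 − p^{−s})^2.) -/
noncomputable section

/-- The group algebra `ℤ_p[G]` for `G` cyclic of order `p`. -/
abbrev L (p : ℕ) [Fact p.Prime] : Type := MonoidAlgebra (PadicInt p) (Multiplicative (ZMod p))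

/-- The fixed generator `g` of `G`, viewed inside `L = ℤ_p[G]`. -/
def gL (p : ℕ) [Fact p.Prime] : L p :=
  MonoidAlgebra.of (PadicInt p) (Multiplicative (ZMod p)) (Multiplicative.ofAdd 1)

/-- The norm element `N = 1 + g + ⋯ + g^(p-1)` of `L`. -/
def NL (p : ℕ) [Fact p.Prime] : L p := ∑ i ∈ Finset.range p, gL p ^ i


/-- `e ∈ L` is a norm-lift if `p·1 = e·(g−1)^(p−1) + α·N` for some `α ∈ ℤ_p`. -/
def IsNormLift (p : ℕ) [Fact p.Prime] (e : L p) : Prop :=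
  ∃ α : PadicInt p, (p : L p) = e * (gL p - 1) ^ (p - 1) + α • NL p

/-- The submodule `(g−1)A` of an `ℤ_p[G]`-module `A`. -/
def commSub (p : ℕ) [Fact p.Prime] (A : Type) [AddCommGroup A] [Module (L p) A] :
    Submodule (L p) A :=
  LinearMap.range (LinearMap.lsmul (L p) A (gL p - 1))

/-- The fixed-point submodule `A^G = {x ∈ A : g·x = x}` of an `ℤ_p[G]`-module `A`. -/
def fixedSub (p : ℕ) [Fact p.Prime] (A : Type) [AddCommGroup A] [Module (L p) A] :
    Submodule (L p) A :=
  LinearMap.ker (LinearMap.lsmul (L p) A (gL p - 1))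

/-- An `ℤ_p[G]`-module has rank 1 if it is nonzero and generated by a single element. -/
def IsRankOne (p : ℕ) [Fact p.Prime] (A : Type) [AddCommGroup A] [Module (L p) A] : Prop :=
  Nontrivial A ∧ ∃ a : A, Submodule.span (L p) {a} = ⊤
structure Good (p : ℕ) [Fact p.Prime] (A : Type) [CommRing A] (q : A →+* ZMod p) (t N : A) :
    Prop where
  tN : t * N = 0
  ker : ∀ x, q x = 0 → ∃ a b, x = t * a + N * b
  unit : ∀ x, q x ≠ 0 → IsUnit x
  pt : ∃ s, (p : A) * t = t * t * s
  tors : ∀ x : A, (p : A) * x = 0 → x = 0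
  fix : ∀ x, t * x = 0 → N * x = p * x
  sep : ∀ x, (∀ l : ℕ, t ^ l ∣ x) → x = 0
  t0 : t ≠ 0
  N0 : N ≠ 0
  val : ∀ y, N * y = 0 ∨ ∃ (k : ℕ) (v : A), IsUnit v ∧ N * y = v * N ^ (k + 1)

namespace Good

variable {p : ℕ} [Fact p.Prime] {A : Type} [CommRing A] {q : A →+* ZMod p} {t N : A}

lemma q_unit {x : A} (h : IsUnit x) : q x ≠ 0 := (h.map q).ne_zero

lemma qt (H : Good p A q t N) : q t = 0 := by
  by_contra h
  have := H.unit _ h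
  exact H.N0 (by simpa using (this.mul_right_eq_zero).1 H.tN)

lemma qN (H : Good p A q t N) : q N = 0 := by
  by_contra h
  have := H.unit _ h
  exact H.t0 ((this.mul_left_eq_zero).1 H.tN)

lemma NN (H : Good p A q t N) : N * N = p * N := H.fix _ H.tN

lemma Npow (H : Good p A q t N) (k : ℕ) : N ^ (k + 1) = (p : A) ^ k * N := by
  induction k with
  | zero => simp
  | succ k ih => rw [pow_succ, ih, mul_assoc, H.NN]; ring

lemma tors_pow (H : Good p A q t N) (k : ℕ) (x : A) (h : (p : A) ^ k * x = 0) : x = 0 := by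
  induction k with
  | zero => simpa using h
  | succ k ih => exact ih (H.tors _ (by rw [← h]; ring))

lemma Npow_mul (H : Good p A q t N) (k : ℕ) (x : A) (h : N ^ (k + 1) * x = 0) : N * x = 0 := by
  rw [H.Npow, mul_assoc] at h
  exact H.tors_pow _ _ h

lemma tpow_mul (H : Good p A q t N) (l : ℕ) (x : A) (h : t ^ (l + 1) * x = 0) : t * x = 0 := by
  obtain ⟨s, hs⟩ := H.pt
  have key : ∀ l : ℕ, (p : A) ^ l * t = t ^ (l + 1) * s ^ l := by
    intro l
    induction l with
    | zero => simp
    | succ l ih =>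
      calc (p : A) ^ (l + 1) * t = (p ^ l * t) * p := by ring
        _ = t ^ l * s ^ l * (p * t) := by rw [ih]; ring
        _ = _ := by rw [hs]; ring
  refine H.tors_pow l _ ?_
  rw [← mul_assoc, key]
  calc _ = (t ^ (l + 1) * x) * s ^ l := by ring
    _ = 0 := by rw [h, zero_mul]

lemma q_of_t (H : Good p A q t N) (l : ℕ) (x : A) (h : t ^ (l + 1) * x = 0) : q x = 0 := by
  by_contra hx
  exact H.t0 (((H.unit x hx).mul_left_eq_zero).1 (H.tpow_mul l x h))

lemma q_of_N (H : Good p A q t N) (l : ℕ) (x : A) (h : N ^ (l + 1) * x = 0) : q x = 0 := by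
  by_contra hx
  exact H.N0 (((H.unit x hx).mul_left_eq_zero).1 (H.Npow_mul l x h))

lemma tNpow (H : Good p A q t N) (l k : ℕ) : t ^ (l + 1) * N ^ (k + 1) = 0 := by
  calc _ = (t * N) * (t ^ l * N ^ k) := by ring
    _ = 0 := by rw [H.tN, zero_mul]

lemma index_step (H : Good p A q t N) (J : Ideal A) (x : A) (hx : x ∉ J)
    (h1 : t * x ∈ J) (h2 : N * x ∈ J) :
    Nat.card (A ⧸ J) = p * Nat.card (A ⧸ (J ⊔ Ideal.span {x})) := by
  have hcomap : J.toAddSubgroup.comap (AddMonoidHom.mulRight x) = q.toAddMonoidHom.ker := by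
    ext y
    simp only [AddSubgroup.mem_comap, AddMonoidHom.mem_ker]
    change y * x ∈ J ↔ q y = 0
    constructor
    · intro h
      by_contra hy
      exact hx ((Ideal.unit_mul_mem_iff_mem J (H.unit y hy)).1 h)
    · intro h
      obtain ⟨a, b, rfl⟩ := H.ker y h
      have : (t * a + N * b) * x = a * (t * x) + b * (N * x) := by ring
      rw [this]
      exact J.add_mem (J.mul_mem_left _ h1) (J.mul_mem_left _ h2)
  have hr : (AddMonoidHom.mulRight x).range = (Ideal.span {x}).toAddSubgroup := by
    ext y
    simp only [AddMonoidHom.mem_range]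
    change _ ↔ y ∈ Ideal.span {x}
    rw [Ideal.mem_span_singleton']
    rfl
  have hi : q.toAddMonoidHom.ker.index = p := by
    rw [AddSubgroup.index_ker]
    have : q.toAddMonoidHom.range = ⊤ := AddMonoidHom.range_eq_top.2 (ZMod.ringHom_surjective q)
    rw [this]
    simp
  have h3 := AddSubgroup.index_comap J.toAddSubgroup (AddMonoidHom.mulRight x)
  rw [hcomap, hi, hr] at h3
  have h4 := AddSubgroup.relIndex_mul_index
    (le_sup_left : J.toAddSubgroup ≤ J.toAddSubgroup ⊔ (Ideal.span {x}).toAddSubgroup)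
  have h5 : J.toAddSubgroup ⊔ (Ideal.span {x}).toAddSubgroup
      = (J ⊔ Ideal.span {x}).toAddSubgroup := by
    ext y
    rw [AddSubgroup.mem_sup]
    change _ ↔ y ∈ J ⊔ Ideal.span {x}
    rw [Submodule.mem_sup]
    rfl
  rw [AddSubgroup.relIndex_sup_left, ← h3, h5] at h4
  exact h4.symm

lemma index_J (H : Good p A q t N) (l k : ℕ) :
    Nat.card (A ⧸ (Ideal.span {t ^ (l + 1)} ⊔ Ideal.span {N ^ (k + 1)})) = p ^ (l + k + 1) := by
  have sub : ∀ (a b : A), a ∣ b → Ideal.span {b} ≤ Ideal.span {a} := fun a b h =>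
    Ideal.span_singleton_le_span_singleton.2 h
  induction l with
  | zero =>
    induction k with
    | zero =>
      rw [H.index_step _ 1]
      · have : (Ideal.span {t ^ (0 + 1)} ⊔ Ideal.span {N ^ (0 + 1)}) ⊔ Ideal.span {1} = (⊤ : Ideal A) := by
          simp
        rw [this]
        have : Nat.card (A ⧸ (⊤ : Ideal A)) = 1 := Nat.card_unique
        rw [this]; simp
      · intro h
        obtain ⟨a, ha, b, hb, hab⟩ := Submodule.mem_sup.1 h
        obtain ⟨a', rfl⟩ := Ideal.mem_span_singleton.1 ha
        obtain ⟨b', rfl⟩ := Ideal.mem_span_singleton.1 hb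
        have := congrArg q hab
        simp [H.qt, H.qN] at this
      · exact Ideal.mem_sup_left (Ideal.mem_span_singleton.2 (by simp))
      · exact Ideal.mem_sup_right (Ideal.mem_span_singleton.2 (by simp))
    | succ k ih =>
      rw [H.index_step _ (N ^ (k + 1))]
      · rw [sup_assoc, sup_eq_right.2 (sub _ _ (pow_dvd_pow N (by lia))), ih]; ring
      · intro h
        obtain ⟨a, ha, b, hb, hab⟩ := Submodule.mem_sup.1 h
        obtain ⟨a', rfl⟩ := Ideal.mem_span_singleton.1 ha
        obtain ⟨b', rfl⟩ := Ideal.mem_span_singleton.1 hb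
        have h0 : N ^ (k + 1 + 1) * (1 - N * b') = 0 := by
          linear_combination (-N) * hab + a' * H.tN
        have := H.q_of_N _ _ h0
        simp [H.qN] at this
      · have := H.tNpow 0 k
        simp only [zero_add, pow_one] at this
        rw [this]; exact zero_mem _
      · exact Ideal.mem_sup_right (Ideal.mem_span_singleton.2 (by rw [pow_succ' N (k + 1)]))
  | succ l ih =>
      rw [H.index_step _ (t ^ (l + 1))]
      · rw [sup_right_comm, sup_eq_right.2 (sub _ _ (pow_dvd_pow t (by lia))), ih]; ring
      · intro h
        obtain ⟨a, ha, b, hb, hab⟩ := Submodule.mem_sup.1 h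
        obtain ⟨a', rfl⟩ := Ideal.mem_span_singleton.1 ha
        obtain ⟨b', rfl⟩ := Ideal.mem_span_singleton.1 hb
        have h0 : t ^ (l + 1 + 1) * (1 - t * a') = 0 := by
          linear_combination (-t) * hab + b' * N ^ k * H.tN
        have := H.q_of_t _ _ h0
        simp [H.qt] at this
      · exact Ideal.mem_sup_left (Ideal.mem_span_singleton.2 (by rw [pow_succ' t (l + 1)]))
      · have := H.tNpow l 0
        simp only [zero_add, pow_one] at this
        rw [mul_comm, this]; exact zero_mem _

lemma index_el (H : Good p A q t N) (l k : ℕ) (c : A) (hc : q c ≠ 0) :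
    Nat.card (A ⧸ Ideal.span {t ^ (l + 1) + c * N ^ (k + 1)}) = p ^ (l + k + 2) := by
  have hcu := H.unit c hc
  rw [H.index_step _ (t ^ (l + 1))]
  · have : Ideal.span {t ^ (l + 1) + c * N ^ (k + 1)} ⊔ Ideal.span {t ^ (l + 1)}
        = Ideal.span {t ^ (l + 1)} ⊔ Ideal.span {N ^ (k + 1)} := by
      apply le_antisymm
      · refine sup_le ?_ le_sup_left
        rw [Ideal.span_singleton_le_iff_mem]
        exact add_mem (Ideal.mem_sup_left (Ideal.mem_span_singleton_self _))
          (Ideal.mul_mem_left _ _ (Ideal.mem_sup_right (Ideal.mem_span_singleton_self _)))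
      · refine sup_le le_sup_right ?_
        rw [Ideal.span_singleton_le_iff_mem, ← Ideal.unit_mul_mem_iff_mem _ hcu]
        exact (Submodule.add_mem_iff_right _
          (Ideal.mem_sup_right (Ideal.mem_span_singleton_self (t ^ (l + 1))))).1
          (Ideal.mem_sup_left (Ideal.mem_span_singleton_self _))
    rw [this, H.index_J]; ring
  · intro h
    obtain ⟨s, hs⟩ := Ideal.mem_span_singleton.1 h
    have h1 : N ^ (k + 1 + 1) * (s * c) = 0 := by
      linear_combination (-N) * hs + t ^ l * (1 - s) * H.tN
    have h2 := H.q_of_N _ _ h1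
    have h3 : t ^ (l + 1 + 1) * (1 - s) = 0 := by
      linear_combination t * hs + s * c * N ^ k * H.tN
    have h4 := H.q_of_t _ _ h3
    simp [hc] at h2
    simp [h2] at h4
  · refine Ideal.mem_span_singleton.2 ⟨t, ?_⟩
    linear_combination (-c * N ^ k) * H.tN
  · have : N * t ^ (l + 1) = 0 := by linear_combination t ^ l * H.tN
    rw [this]; exact zero_mem _

lemma nzd (H : Good p A q t N) (l k : ℕ) (c : A) (hc : q c ≠ 0) (s : A)
    (h : s * (t ^ (l + 1) + c * N ^ (k + 1)) = 0) : s = 0 := by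
  have hcu := H.unit c hc
  have h1 : N ^ (k + 1 + 1) * (s * c) = 0 := by
    linear_combination N * h - s * t ^ l * H.tN
  have h2 : N * s = 0 := by
    have := H.Npow_mul _ _ h1
    rw [← mul_assoc] at this
    exact (hcu.mul_left_eq_zero).1 this
  have h3 : t ^ (l + 1 + 1) * s = 0 := by
    linear_combination t * h - s * c * N ^ k * H.tN
  have h4 := H.tpow_mul _ _ h3
  exact H.tors _ (by rw [← H.fix _ h4, h2])

lemma inj (H : Good p A q t N) (l k l' k' : ℕ) (c c' : A) (hc : q c ≠ 0) (hc' : q c' ≠ 0)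
    (h : Ideal.span {t ^ (l + 1) + c * N ^ (k + 1)} = Ideal.span {t ^ (l' + 1) + c' * N ^ (k' + 1)})
    (hs : l + k = l' + k') :
    l = l' ∧ q c = q c' := by
  wlog hl : l ≤ l' generalizing l k l' k' c c'
  · have := this l' k' l k c' c hc' hc h.symm hs.symm (by lia)
    exact ⟨this.1.symm, this.2.symm⟩
  obtain ⟨s, hs1⟩ := Ideal.span_singleton_le_span_singleton.1 h.ge
  obtain ⟨s', hs2⟩ := Ideal.span_singleton_le_span_singleton.1 h.le
  have hss : s' * s - 1 = 0 := by
    refine H.nzd l k c hc _ ?_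
    linear_combination (-1) * hs2 - s' * hs1
  have hqs : q s ≠ 0 := by
    intro h0
    have := congrArg q hss
    simp [h0] at this
  obtain ⟨d, rfl⟩ := Nat.exists_eq_add_of_le hl
  have h1 : t ^ (l + 1 + 1) * (s - t ^ d) = 0 := by
    linear_combination (-t) * hs1 + (c' * N ^ k' - s * c * N ^ k) * H.tN
  have h2 := H.q_of_t _ _ h1
  rcases d with _ | d
  · obtain rfl : k = k' := by lia
    have h3 : N ^ (k + 1 + 1) * (s * c - c') = 0 := by
      linear_combination (-N) * hs1 + t ^ l * (1 - s) * H.tN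
    have h4 := H.q_of_N _ _ h3
    refine ⟨rfl, ?_⟩
    simp only [pow_zero, map_sub, map_one, map_mul] at h2 h4
    linear_combination h4 - q c * h2
  · simp [H.qt] at h2
    exact absurd h2 hqs

lemma surj (H : Good p A q t N) (a : A) (ha : q a = 0) (hnz : ∀ s, s * a = 0 → s = 0) :
    ∃ (l k : ℕ) (c : (ZMod p)ˣ), Ideal.span {a} =
      Ideal.span {t ^ (l + 1) + (((c : ZMod p).val : ℕ) : A) * N ^ (k + 1)} := by
  obtain ⟨x, y, rfl⟩ := H.ker a ha
  have ht : ∃ (l : ℕ) (u : A), IsUnit u ∧ t * x = t ^ (l + 1) * u := by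
    by_contra! hcon
    have : ∀ l : ℕ, ∃ z, t * x = t ^ (l + 1) * z := by
      intro l
      induction l with
      | zero => exact ⟨x, by ring⟩
      | succ l ih =>
        obtain ⟨z, hz⟩ := ih
        have : q z = 0 := by
          by_contra h
          exact hcon l z (H.unit z h) hz
        obtain ⟨a, b, rfl⟩ := H.ker z this
        exact ⟨a, by linear_combination hz + t ^ l * b * H.tN⟩
    have h0 : t * x = 0 := H.sep _ fun l => by
      obtain ⟨z, hz⟩ := this l
      exact ⟨t * z, by rw [hz]; ring⟩
    refine H.t0 (hnz t ?_)
    linear_combination t * h0 + y * H.tN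
  obtain ⟨l, u, hu, hx⟩ := ht
  rcases H.val y with h0 | ⟨k, v, hv, hy⟩
  · exact absurd (hnz N (by linear_combination N * h0 + x * H.tN)) H.N0
  obtain ⟨u, rfl⟩ := hu
  obtain ⟨v, rfl⟩ := hv
  let w : Aˣ := u⁻¹ * v
  have hw : q (w : A) ≠ 0 := q_unit w.isUnit
  let c : (ZMod p)ˣ := Units.mk0 _ hw
  have hqc : q (((c : ZMod p).val : ℕ) : A) = q w := by
    rw [map_natCast, ZMod.natCast_zmod_val]; rfl
  obtain ⟨C, hC⟩ := H.unit (((c : ZMod p).val : ℕ) : A) (by rw [hqc]; exact hw)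
  refine ⟨l, k, c, ?_⟩
  rw [← hC] at hqc ⊢
  obtain ⟨α, β, hab⟩ := H.ker ((C⁻¹ : Aˣ) * (w : A) - 1) (by
    rw [map_sub, map_mul, ← hqc, ← map_mul]; simp)
  have hsu : IsUnit (1 + N * β) := H.unit _ (by simp [H.qN])
  obtain ⟨S, hS⟩ := hsu
  have key : t * x + N * y = (t ^ (l + 1) + C * N ^ (k + 1)) * ((u * S : Aˣ) : A) := by
    have e1 : (C : A) * (C⁻¹ : Aˣ) = 1 := by simp
    have e2 : (u : A) * (w : A) = v := by simp [w]
    rw [hx, hy, Units.val_mul, hS]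
    have e3 : (w : A) = C * (1 + t * α + N * β) := by
      linear_combination (C : A) * hab - w * e1
    rw [← e2, e3]
    linear_combination (u * C * α * N ^ k - t ^ l * u * β) * H.tN
  rw [key, Ideal.span_singleton_mul_right_unit (Units.isUnit _)]

lemma count (H : Good p A q t N) (n : ℕ) :
    Nat.card {M : Submodule A A // Nat.card (A ⧸ M) = p ^ (n + 1) ∧ Module.Free A M}
      = n * (p - 1) := by
  have hp : p.Prime := Fact.out
  have : Nontrivial A := ⟨⟨_, _, H.t0⟩⟩
  have hq : ∀ c : (ZMod p)ˣ, q (((c : ZMod p).val : ℕ) : A) = c := by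
    intro c
    rw [map_natCast, ZMod.natCast_zmod_val]
  have hq0 : ∀ c : (ZMod p)ˣ, q (((c : ZMod p).val : ℕ) : A) ≠ 0 := by
    intro c; rw [hq]; exact c.ne_zero
  have hfree : ∀ a : A, (∀ s, s * a = 0 → s = 0) → Module.Free A (Ideal.span {a}) := by
    intro a ha
    have hinj : Function.Injective (LinearMap.toSpanSingleton A A a) := by
      rw [injective_iff_map_eq_zero]
      intro s hs
      exact ha s (by simpa using hs)
    have e := LinearEquiv.ofInjective _ hinj
    rw [LinearMap.range_toSpanSingleton] at e
    exact Module.Free.of_equiv e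
  let F : Fin n × (ZMod p)ˣ →
      {M : Submodule A A // Nat.card (A ⧸ M) = p ^ (n + 1) ∧ Module.Free A M} := fun x =>
    ⟨Ideal.span {t ^ (x.1.val + 1) + (((x.2 : ZMod p).val : ℕ) : A) * N ^ (n - 1 - x.1.val + 1)}, by
      constructor
      · rw [H.index_el _ _ _ (hq0 _)]
        congr 1
        have := x.1.2
        lia
      · exact hfree _ (H.nzd _ _ _ (hq0 _))⟩
  have hF : Function.Bijective F := by
    constructor
    · rintro ⟨i, c⟩ ⟨j, d⟩ h
      have h := congrArg Subtype.val h
      have := H.inj _ _ _ _ _ _ (hq0 c) (hq0 d) h (by have := i.2; have := j.2; simp; lia)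
      rw [hq, hq] at this
      exact Prod.ext (Fin.ext this.1) (Units.ext this.2)
    · rintro ⟨M, hM, hfr⟩
      obtain ⟨⟨I, b⟩⟩ := Module.Free.exists_basis (R := A) (M := M)
      have hsub : Subsingleton I := by
        constructor
        intro i j
        by_contra hij
        have h1 : ((b i : M) : A) • b j - ((b j : M) : A) • b i = 0 := by
          apply Subtype.ext
          simp [mul_comm]
        have h2 := congrArg (fun z => b.repr z i) h1
        simp [Ne.symm hij] at h2
        exact b.ne_zero j h2
      have hne : Nonempty I := by
        by_contra hI
        rw [not_nonempty_iff] at hI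
        have hMs : Subsingleton M := b.repr.toEquiv.subsingleton
        have hMb : M = ⊥ := Submodule.eq_bot_of_subsingleton
        have hcard : Nat.card A = p ^ (n + 1) := by
          rw [← hM, hMb]
          exact Nat.card_congr (Submodule.quotEquivOfEqBot (⊥ : Submodule A A) rfl).symm.toEquiv
        have h1 : Nat.card A • (1 : A) = 0 := card_nsmul_eq_zero'
        rw [hcard, nsmul_eq_mul, Nat.cast_pow] at h1
        exact one_ne_zero (H.tors_pow _ _ h1)
      obtain ⟨i⟩ := hne
      have hMa : M = Ideal.span {((b i : M) : A)} := by
        apply le_antisymm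
        · intro m hm
          have h1 := b.linearCombination_repr ⟨m, hm⟩
          have : Unique I := ⟨⟨i⟩, fun j => Subsingleton.elim _ _⟩
          rw [Finsupp.linearCombination_unique] at h1
          have h2 := congrArg Subtype.val h1
          rw [Ideal.mem_span_singleton']
          rw [Subsingleton.elim default i] at h2
          exact ⟨_, h2⟩
        · rw [Ideal.span_singleton_le_iff_mem]
          exact (b i).2
      have hnz : ∀ s, s * ((b i : M) : A) = 0 → s = 0 := by
        intro s hs
        have h1 : s • b i = 0 := Subtype.ext hs
        have h2 := congrArg (fun z => b.repr z i) h1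
        simpa using h2
      have hqa : q ((b i : M) : A) = 0 := by
        by_contra hu
        rw [Ideal.span_singleton_eq_top.2 (H.unit _ hu)] at hMa
        rw [hMa] at hM
        have h1 : Nat.card (A ⧸ (⊤ : Ideal A)) = 1 := Nat.card_unique
        have h2 : 1 = p ^ (n + 1) := h1.symm.trans hM
        exact (Nat.one_lt_pow (by lia) hp.one_lt).ne h2
      obtain ⟨l, k, c, hlk⟩ := H.surj _ hqa hnz
      rw [hlk] at hMa
      have hc := H.index_el l k _ (hq0 c)
      rw [hMa] at hM
      have h3 := Nat.pow_right_injective hp.two_le (hc.symm.trans hM)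
      refine ⟨⟨⟨l, by lia⟩, c⟩, Subtype.ext ?_⟩
      have h4 : n - 1 - l = k := by lia
      simp only [F, h4]
      exact hMa.symm
  rw [← Nat.card_congr (Equiv.ofBijective F hF), Nat.card_prod, Nat.card_fin, Nat.card_eq_fintype_card,
    ZMod.card_units]

end Good
section
variable (p : ℕ) [Fact p.Prime]

def eps : L p →ₐ[PadicInt p] PadicInt p := MonoidAlgebra.lift (PadicInt p) (PadicInt p) (Multiplicative (ZMod p)) 1

lemma eps_g : eps p (gL p) = 1 := by
  simp [eps, gL]

lemma g_pow : gL p ^ p = 1 := by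
  rw [gL, ← map_pow, ← ofAdd_nsmul]
  simp [MonoidAlgebra.one_def]

lemma of_eq_gpow (m : Multiplicative (ZMod p)) :
    MonoidAlgebra.of (PadicInt p) (Multiplicative (ZMod p)) m = gL p ^ (m.toAdd.val) := by
  rw [gL, ← map_pow, ← ofAdd_nsmul]
  simp

lemma dvd_sub_eps (x : L p) : gL p - 1 ∣ x - algebraMap _ _ (eps p x) := by
  induction x using MonoidAlgebra.induction_linear with
  | zero => simp
  | add x y hx hy =>
    rw [map_add, map_add, add_sub_add_comm]
    exact dvd_add hx hy
  | single m r =>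
    have h1 : (MonoidAlgebra.single m r : L p)
        = algebraMap _ _ r * MonoidAlgebra.of (PadicInt p) (Multiplicative (ZMod p)) m := by
      simp [MonoidAlgebra.single_mul_single]
    rw [h1, map_mul, AlgHom.commutes, of_eq_gpow, map_pow, eps_g]
    simp only [one_pow, mul_one, Algebra.algebraMap_self, RingHom.id_apply]
    have : (algebraMap (PadicInt p) (L p)) r * gL p ^ (Multiplicative.toAdd m).val - algebraMap (PadicInt p) (L p) r
      = algebraMap (PadicInt p) (L p) r * (gL p ^ (Multiplicative.toAdd m).val - 1) := by ring
    rw [this]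
    exact Dvd.dvd.mul_left (sub_one_dvd_pow_sub_one _ _) _

lemma tN : (gL p - 1) * NL p = 0 := by
  rw [NL, mul_geom_sum, g_pow, sub_self]

lemma eps_N : eps p (NL p) = p := by
  simp [NL, eps_g]

lemma p_mul_coeff (j : ℕ) (x : L p) (m) : ((p : L p) ^ j * x).coeff m = (p : PadicInt p) ^ j * x.coeff m := by
  have : (p : L p) ^ j * x = ((p : PadicInt p) ^ j) • x := by
    rw [Algebra.smul_def, map_pow, map_natCast]
  rw [this, MonoidAlgebra.coeff_smul_apply, smul_eq_mul]

lemma p_ne : (p : PadicInt p) ≠ 0 := by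
  exact_mod_cast (Fact.out : p.Prime).ne_zero

lemma good : Good p (L p) (PadicInt.toZMod.comp (eps p : L p →+* PadicInt p)) (gL p - 1) (NL p) := by
  have hp : p.Prime := Fact.out
  have hker : ∀ x, PadicInt.toZMod.comp (eps p : L p →+* PadicInt p) x = 0 →
      ∃ a b, x = (gL p - 1) * a + NL p * b := by
    intro x hx
    have h1 : eps p x ∈ RingHom.ker (PadicInt.toZMod : PadicInt p →+* ZMod p) := hx
    rw [PadicInt.ker_toZMod, PadicInt.maximalIdeal_eq_span_p, Ideal.mem_span_singleton] at h1
    obtain ⟨y, hy⟩ := h1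
    obtain ⟨a, ha⟩ := dvd_sub_eps p (x - NL p * algebraMap _ _ y)
    rw [map_sub, map_mul, AlgHom.commutes, eps_N, hy] at ha
    simp at ha
    exact ⟨a, algebraMap _ _ y, by simp; linear_combination ha⟩
  obtain ⟨r, hr⟩ := exists_add_pow_prime_eq hp (gL p - 1) 1
  have htp : (gL p - 1) ^ p = p * (-((gL p - 1) * r)) := by
    rw [sub_add_cancel, g_pow, one_pow] at hr
    linear_combination -hr
  have hN0 : NL p ≠ 0 := fun h => by
    have := eps_N p
    rw [h, map_zero] at this
    exact p_ne p this.symm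
  have hNN : NL p * NL p = p * NL p := by
    obtain ⟨a, ha⟩ := dvd_sub_eps p (NL p)
    rw [eps_N] at ha
    simp at ha
    linear_combination NL p * ha + a * tN p
  refine ⟨tN p, hker, ?_, ?_, ?_, ?_, ?_, ?_, hN0, ?_⟩
  · intro x hx
    by_contra hu
    obtain ⟨P, hP, hxP⟩ := exists_max_ideal_of_mem_nonunits hu
    have hfin : Module.Finite (PadicInt p) (L p) := inferInstance
    have hmax := Ideal.isMaximal_comap_of_isIntegral_of_isMaximal (R := PadicInt p) P
    have hpP : (p : L p) ∈ P := by
      have h1 := IsLocalRing.eq_maximalIdeal hmax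
      have h2 : (p : PadicInt p) ∈ Ideal.comap (algebraMap (PadicInt p) (L p)) P := by
        rw [h1, PadicInt.maximalIdeal_eq_span_p]
        exact Ideal.mem_span_singleton_self _
      simpa using h2
    have htP : gL p - 1 ∈ P := by
      refine hP.isPrime.mem_of_pow_mem p ?_
      rw [htp]
      exact P.mul_mem_right _ hpP
    have hePx : algebraMap _ _ (eps p x) ∈ P := by
      have := P.mem_of_dvd (dvd_sub_eps p x) htP
      have := P.sub_mem hxP this
      rwa [sub_sub_cancel] at this
    have hue : IsUnit (eps p x) := by
      by_contra h
      have : eps p x ∈ RingHom.ker (PadicInt.toZMod : PadicInt p →+* ZMod p) := by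
        rw [PadicInt.ker_toZMod]; exact h
      exact hx this
    exact hP.ne_top (Ideal.eq_top_of_isUnit_mem _ hePx (hue.map _))
  · obtain ⟨s, hs⟩ := dvd_sub_eps p (NL p)
    rw [eps_N] at hs
    simp at hs
    refine ⟨-s, ?_⟩
    linear_combination -(gL p - 1) * hs + tN p
  · intro x hx
    ext m
    have h1 := p_mul_coeff p 1 x m
    rw [pow_one, hx] at h1
    simpa [p_ne p] using h1
  · intro x hx
    have h1 : ∀ i : ℕ, gL p ^ i * x = x := by
      intro i
      induction i with
      | zero => simp
      | succ i ih => rw [pow_succ]; linear_combination ih + gL p ^ i * hx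
    rw [NL, Finset.sum_mul]
    simp [h1]
  · intro x hx
    ext m
    have h1 : ∀ j : ℕ, (p : PadicInt p) ^ j ∣ x.coeff m := by
      intro j
      obtain ⟨z, hz⟩ := hx (p * j)
      rw [pow_mul, htp, mul_pow, mul_assoc] at hz
      rw [hz, p_mul_coeff]
      exact dvd_mul_right _ _
    by_contra h0
    have h0 : x.coeff m ≠ 0 := h0
    have h2 := h1 ((x.coeff m).valuation + 1)
    rw [← Ideal.mem_span_singleton, PadicInt.mem_span_pow_iff_le_valuation _ h0] at h2
    lia
  · intro h
    rw [sub_eq_zero, gL, ← map_one (MonoidAlgebra.of (PadicInt p) (Multiplicative (ZMod p)))] at h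
    have h1 := MonoidAlgebra.of_injective h
    have h2 : (1 : ZMod p) = 0 := h1
    exact one_ne_zero h2
  · intro y
    obtain ⟨a, ha⟩ := dvd_sub_eps p y
    have h1 : NL p * y = NL p * algebraMap _ _ (eps p y) := by
      linear_combination NL p * ha + a * tN p
    by_cases h0 : eps p y = 0
    · left; rw [h1, h0]; simp
    · right
      have hk : ∀ k : ℕ, NL p ^ (k + 1) = NL p * (p : L p) ^ k := by
        intro k
        induction k with
        | zero => simp
        | succ k ih => rw [pow_succ, ih]; linear_combination (p : L p) ^ k * hNN
      refine ⟨(eps p y).valuation, algebraMap _ _ (PadicInt.unitCoeff h0 : PadicInt p),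
        (Units.isUnit _).map _, ?_⟩
      rw [h1, hk]
      conv_lhs => rw [PadicInt.unitCoeff_spec h0]
      rw [map_mul, map_pow, map_natCast]
      ring

end

open PowerSeries in
/-- if `c n` is the number of `L`-submodules `M ⊆ L` with `|L/M| = p^n` which
are free as `L`-modules, then `(1 − X)² · ∑_{n≥1} c(n)Xⁿ = (p−1)X²` in `ℤ⟦X⟧` (equivalently,
`Z_coh(L;s) = (p−1)p^{−2s}/(1 − p^{−s})²`). -/
theorem stmt_13 (p : ℕ) [Fact p.Prime] (c : ℕ → ℕ)
    (hc : ∀ n : ℕ, c n = Nat.card {M : Submodule (L p) (L p) //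
        Nat.card (L p ⧸ M) = p ^ n ∧ Module.Free (L p) M}) :
    (1 - X) ^ 2 * PowerSeries.mk (fun n => if n = 0 then 0 else (c n : ℤ))
      = ((p : ℤ) - 1) • X ^ 2 := by
  have hp : p.Prime := Fact.out
  have h : ∀ n, c (n + 1) = n * (p - 1) := fun n => by rw [hc, (good p).count]
  have hm : PowerSeries.mk (fun n => if n = 0 then 0 else (c n : ℤ))
      = ((p : ℤ) - 1) • (X * PowerSeries.mk (fun n => (n : ℤ))) := by
    ext n
    rcases n with _ | n
    · simp
    · rw [map_zsmul, coeff_succ_X_mul, coeff_mk, coeff_mk, if_neg (by lia), h, Nat.cast_mul,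
        Nat.cast_sub hp.one_le, smul_eq_mul]
      push_cast; ring
  have h2 : (1 - X) ^ 2 * (PowerSeries.mk (fun n => (n : ℤ))) = X := by
    have h3 : (PowerSeries.mk (fun n => (n : ℤ))) * (1 - X) = X * PowerSeries.mk 1 := by
      ext n
      rcases n with _ | n
      · simp
      · simp [mul_sub, coeff_succ_mul_X, coeff_succ_X_mul]
    have h4 := PowerSeries.mk_one_mul_one_sub_eq_one ℤ
    calc _ = ((PowerSeries.mk (fun n => (n : ℤ))) * (1 - X)) * (1 - X) := by ring
      _ = X := by rw [h3, mul_assoc, h4, mul_one]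
  rw [hm, mul_smul_comm]
  congr 1
  linear_combination X * h2
end
end

section
/- Let A be a finite rank-1 ℤ_p[G]-module and let p^r = |(g−1)A|. Then the submodule (g−1)A is isomorphic, as an L-module, to the quotient L/⟨N, (g−1)^r⟩ of L by the L-submodule generated by N and (g−1)^r; in particular (g−1)^(r+1)·A = 0, and if r ≥ 1 then (g−1)^r·A ≠ 0. -/
noncomputable section

lemma aux_gp (p : ℕ) [Fact p.Prime] : gL p ^ p = 1 := by
  unfold gL
  rw [← map_pow, ← ofAdd_nsmul]
  simp
  rfl

lemma aux_Npi (p : ℕ) [Fact p.Prime] : NL p * (gL p - 1) = 0 := by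
  unfold NL
  rw [geom_sum_mul, aux_gp, sub_self]

lemma aux_pip (p : ℕ) [Fact p.Prime] : ∃ u : L p, (gL p - 1) ^ p = (p : L p) * u := by
  obtain ⟨s, hs⟩ := exists_add_pow_prime_eq (Fact.out : p.Prime) (gL p - 1) 1
  refine ⟨-((gL p - 1) * s), ?_⟩
  rw [sub_add_cancel, aux_gp] at hs
  simp only [one_pow, mul_one] at hs
  linear_combination -hs

lemma aux_gk (p : ℕ) [Fact p.Prime] (k : ℕ) :
    gL p ^ k - 1 ∈ Ideal.span {gL p - 1, NL p} := by
  have h : gL p - 1 ∣ gL p ^ k - 1 := sub_one_dvd_pow_sub_one _ _ 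
  exact Ideal.mem_of_dvd _ h (Ideal.subset_span (by simp))

lemma aux_p (p : ℕ) [Fact p.Prime] : (p : L p) ∈ Ideal.span {gL p - 1, NL p} := by
  have h1 : ∑ k ∈ Finset.range p, (gL p ^ k - 1) ∈ Ideal.span {gL p - 1, NL p} :=
    Ideal.sum_mem _ fun k _ => aux_gk p k
  have h2 : NL p ∈ Ideal.span {gL p - 1, NL p} := Ideal.subset_span (by simp)
  have h3 := Ideal.sub_mem _ h2 h1
  rw [Finset.sum_sub_distrib] at h3
  simpa [NL] using h3

lemma aux_nat (p : ℕ) [Fact p.Prime] (x : L p) :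
    ∃ c : ℕ, x - (c : L p) ∈ Ideal.span {gL p - 1, NL p} := by
  induction x using MonoidAlgebra.induction_on with
  | of h =>
    refine ⟨1, ?_⟩
    have : MonoidAlgebra.of (PadicInt p) (Multiplicative (ZMod p)) h
        = gL p ^ (Multiplicative.toAdd h).val := by
      unfold gL
      rw [← map_pow, ← ofAdd_nsmul]
      simp
    rw [this]
    simpa using aux_gk p _
  | add x y hx hy =>
    obtain ⟨c, hc⟩ := hx
    obtain ⟨d, hd⟩ := hy
    refine ⟨c + d, ?_⟩
    have := Ideal.add_mem _ hc hd
    convert this using 1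
    push_cast; ring
  | smul a x hx =>
    obtain ⟨c, hc⟩ := hx
    obtain ⟨-, ha⟩ := PadicInt.zmodRepr_spec a
    rw [PadicInt.maximalIdeal_eq_span_p, Ideal.mem_span_singleton] at ha
    obtain ⟨t, ht⟩ := ha
    set n := PadicInt.zmodRepr a
    refine ⟨n * c, ?_⟩
    have ha' : a = n + p * t := by linear_combination ht
    have e : a • x - ((n * c : ℕ) : L p)
        = algebraMap (PadicInt p) (L p) t * x * (p : L p) + (n : L p) * (x - c) := by
      rw [Algebra.smul_def, ha']
      simp only [map_add, map_mul, map_natCast]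
      push_cast; ring
    rw [e]
    exact Ideal.add_mem _ (Ideal.mul_mem_left _ _ (aux_p p)) (Ideal.mul_mem_left _ _ hc)

lemma aux_dec (p : ℕ) [Fact p.Prime] (x : L p) :
    ∃ (c : Fin p) (y z : L p), x = (c : ℕ) + y * (gL p - 1) + z * NL p := by
  obtain ⟨c, hc⟩ := aux_nat p x
  have hp : 0 < p := (Fact.out : p.Prime).pos
  have h : x - ((c % p : ℕ) : L p) ∈ Ideal.span {gL p - 1, NL p} := by
    have e : x - ((c % p : ℕ) : L p) = (x - c) + ((c / p : ℕ) : L p) * (p : L p) := by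
      have := congrArg (Nat.cast : ℕ → L p) (Nat.mod_add_div c p)
      push_cast at this
      linear_combination -this
    rw [e]
    exact Ideal.add_mem _ hc (Ideal.mul_mem_left _ _ (aux_p p))
  obtain ⟨y, z, hyz⟩ := Ideal.mem_span_pair.1 h
  exact ⟨⟨c % p, Nat.mod_lt _ hp⟩, y, z, by simp only []; linear_combination -hyz⟩

lemma aux_dec' (p : ℕ) [Fact p.Prime] (n : ℕ) (x : L p) :
    ∃ (c : Fin n → Fin p) (y z : L p),
      x = (∑ i, ((c i : ℕ) : L p) * (gL p - 1) ^ (i : ℕ)) + y * (gL p - 1) ^ n + z * NL p := by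
  induction n with
  | zero => exact ⟨Fin.elim0, x, 0, by simp⟩
  | succ n ih =>
    obtain ⟨c, y, z, h⟩ := ih
    obtain ⟨d, y', z', h'⟩ := aux_dec p y
    refine ⟨Fin.snoc c d, y', z + z' * (gL p - 1) ^ n, ?_⟩
    rw [Fin.sum_univ_castSucc]
    simp only [Fin.snoc_castSucc, Fin.snoc_last, Fin.val_castSucc, Fin.val_last]
    rw [h, h']
    ring

lemma aux_card (p : ℕ) [Fact p.Prime] (M : Type) [AddCommGroup M] [Module (L p) M] (m : M)
    (hm : ∀ x : M, ∃ l : L p, l • m = x) (hN : NL p • m = 0) (n : ℕ)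
    (hn : (gL p - 1) ^ n • m = 0) : Finite M ∧ Nat.card M ≤ p ^ n := by
  let f : (Fin n → Fin p) → M := fun c =>
    (∑ i, ((c i : ℕ) : L p) * (gL p - 1) ^ (i : ℕ)) • m
  have hf : Function.Surjective f := by
    intro x
    obtain ⟨l, rfl⟩ := hm x
    obtain ⟨c, y, z, h⟩ := aux_dec' p n l
    refine ⟨c, ?_⟩
    rw [h, add_smul, add_smul, mul_smul, mul_smul, hN, hn]
    simp [f]
  refine ⟨Finite.of_surjective f hf, ?_⟩
  have := Nat.card_le_card_of_surjective f hf
  simpa using this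

lemma aux_nil (p : ℕ) [Fact p.Prime] (M : Type) [AddCommGroup M] [Module (L p) M] (r : ℕ)
    (h : Nat.card M = p ^ r) (x : M) : (gL p - 1) ^ (p * r) • x = 0 := by
  obtain ⟨u, hu⟩ := aux_pip p
  rw [pow_mul, hu, mul_pow, mul_comm, mul_smul]
  have : ((p : L p) ^ r) • x = 0 := by
    rw [← Nat.cast_pow, Nat.cast_smul_eq_nsmul, ← h]
    exact card_nsmul_eq_zero'
  rw [this, smul_zero]

lemma aux_kill (p : ℕ) [Fact p.Prime] (r : ℕ) : ∀ (M : Type) [AddCommGroup M] [Module (L p) M],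
    Nat.card M = p ^ r → ∀ x : M, (gL p - 1) ^ r • x = 0 := by
  induction r using Nat.strong_induction_on with
  | _ r ih =>
  intro M _ _ h x
  have hp : p.Prime := Fact.out
  have : Finite M := Nat.finite_of_card_ne_zero (by rw [h]; exact pow_ne_zero _ hp.ne_zero)
  let f : M →ₗ[L p] M := LinearMap.lsmul (L p) M (gL p - 1)
  have hdvd : Nat.card (LinearMap.range f) ∣ p ^ r := by
    rw [← h]
    exact AddSubgroup.card_addSubgroup_dvd_card (LinearMap.range f).toAddSubgroup
  obtain ⟨s, hs, hs'⟩ := (Nat.dvd_prime_pow hp).1 hdvd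
  rcases hs.lt_or_eq with hlt | rfl
  · have := ih s hlt (LinearMap.range f) hs' ⟨f x, ⟨x, rfl⟩⟩
    have h2 : (gL p - 1) ^ (s + 1) • x = 0 := by
      have h3 := congrArg Subtype.val this
      rw [pow_succ, mul_smul]
      exact h3
    obtain ⟨t, rfl⟩ := Nat.exists_eq_add_of_lt hlt
    rw [show s + t + 1 = t + (s + 1) by ring, pow_add, mul_smul, h2, smul_zero]
  · have hsurj : Function.Surjective f := by
      have : (LinearMap.range f : Set M) = Set.univ := by
        apply Set.eq_of_subset_of_ncard_le (Set.subset_univ _) _ (Set.toFinite _)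
        rw [Set.ncard_univ, h, ← hs']
        exact le_of_eq rfl
      exact Set.range_eq_univ.1 this
    have hit : ∀ k : ℕ, ∀ y : M, ∃ z : M, (gL p - 1) ^ k • z = y := by
      intro k
      induction k with
      | zero => exact fun y => ⟨y, by simp⟩
      | succ k ihk =>
        intro y
        obtain ⟨z, hz⟩ := ihk y
        obtain ⟨w, hw⟩ := hsurj z
        refine ⟨w, ?_⟩
        rw [pow_succ, mul_smul, ← hz, ← hw]
        rfl
    obtain ⟨z, hz⟩ := hit (p * s) x
    rw [← hz, aux_nil p M s h, smul_zero]

/-- for a finite rank-1 `ℤ_p[G]`-module `A` with `|(g−1)A| = p^r`, the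
submodule `(g−1)A` is `L`-isomorphic to `L/⟨N, (g−1)^r⟩`; in particular
`(g−1)^(r+1)·A = 0`, and `(g−1)^r·A ≠ 0` whenever `r ≥ 1`. -/
theorem stmt_17 (p : ℕ) [Fact p.Prime]
    (A : Type) [AddCommGroup A] [Module (L p) A] [Finite A]
    (hA : IsRankOne p A) (r : ℕ)
    (hcard : Nat.card (commSub p A) = p ^ r) :
    Nonempty ((commSub p A) ≃ₗ[L p]
        (L p ⧸ Submodule.span (L p) {NL p, (gL p - 1) ^ r})) ∧
    (∀ x : A, (gL p - 1) ^ (r + 1) • x = 0) ∧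
    (1 ≤ r → ∃ x : A, (gL p - 1) ^ r • x ≠ 0) := by
  have hp : p.Prime := Fact.out
  obtain ⟨-, a, ha⟩ := hA
  have ha' : ∀ x : A, ∃ l : L p, l • a = x := fun x =>
    Submodule.mem_span_singleton.1 (ha ▸ Submodule.mem_top)
  let b : commSub p A := ⟨(gL p - 1) • a, ⟨a, rfl⟩⟩
  have hb : ∀ x : commSub p A, ∃ l : L p, l • b = x := by
    rintro ⟨x, y, rfl⟩
    obtain ⟨l, rfl⟩ := ha' y
    refine ⟨l, Subtype.ext ?_⟩
    change l • (gL p - 1) • a = (gL p - 1) • l • a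
    rw [smul_comm]
  have hN : NL p • b = 0 := by
    apply Subtype.ext
    change NL p • (gL p - 1) • a = 0
    rw [← mul_smul, aux_Npi, zero_smul]
  have hk := aux_kill p r (commSub p A) hcard
  refine ⟨?_, ?_, ?_⟩
  · let I : Submodule (L p) (L p) := Submodule.span (L p) {NL p, (gL p - 1) ^ r}
    let q : L p →ₗ[L p] commSub p A := LinearMap.toSpanSingleton (L p) _ b
    have hI : I ≤ LinearMap.ker q := by
      refine Submodule.span_le.2 ?_
      rintro x (rfl | rfl)
      · simpa [q] using hN
      · simpa [q] using hk b
    let f : (L p ⧸ I) →ₗ[L p] commSub p A := I.liftQ q hI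
    have hf : Function.Surjective f := by
      intro x
      obtain ⟨l, rfl⟩ := hb x
      exact ⟨Submodule.Quotient.mk l, rfl⟩
    have key : ∀ y ∈ I, y • (Submodule.Quotient.mk 1 : L p ⧸ I) = 0 := by
      intro y hy
      rw [← Submodule.Quotient.mk_smul, Submodule.Quotient.mk_eq_zero]
      simpa using hy
    obtain ⟨hfin, hle⟩ := aux_card p (L p ⧸ I) (Submodule.Quotient.mk 1)
      (by
        intro x
        obtain ⟨l, rfl⟩ := Submodule.Quotient.mk_surjective _ x
        exact ⟨l, by rw [← Submodule.Quotient.mk_smul]; simp⟩)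
      (key _ (Submodule.subset_span (by simp))) r (key _ (Submodule.subset_span (by simp)))
    have hbij : Function.Bijective f := by
      refine (Nat.bijective_iff_surjective_and_card f).2 ⟨hf, le_antisymm ?_ ?_⟩
      · rw [hcard]; exact hle
      · exact Nat.card_le_card_of_surjective f hf
    exact ⟨(LinearEquiv.ofBijective f hbij).symm⟩
  · intro x
    have := congrArg Subtype.val (hk ⟨(gL p - 1) • x, ⟨x, rfl⟩⟩)
    rw [pow_succ, mul_smul]
    simpa using this
  · intro hr
    obtain ⟨s, rfl⟩ := Nat.exists_eq_add_of_le' hr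
    refine ⟨a, fun h0 => ?_⟩
    have h1 : (gL p - 1) ^ s • b = 0 := by
      apply Subtype.ext
      change (gL p - 1) ^ s • (gL p - 1) • a = 0
      rw [← mul_smul, ← pow_succ, h0]
    have := (aux_card p (commSub p A) b hb hN s h1).2
    rw [hcard] at this
    exact absurd this (not_le.2 (Nat.pow_lt_pow_right hp.one_lt (Nat.lt_succ_self s)))
end
end
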